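/- Let λ>0 and b∈(0,1). There exists N∈ℕ such that for every integer m ≥ N, each sign σ∈{+,−}, and every integer k ≥ 2: Δ_m(λ,b) > 0, det M_m(λ,b,Ω_m^σ(λ,b)) = 0, and det M_{k·m}(λ,b,Ω_m^σ(λ,b)) ≠ 0. (This is the key to the one-dimensionality of the kernel of the linearized operator in the m-fold symmetric spaces.) -/

import Mathlib

open Real MeasureTheory Filter

/-- Modified Bessel function of the first kind `I_n`. -/
noncomputable def besselI (n : ℕ) (x : ℝ) : ℝ :=
  ∑' m : ℕ, (x / 2) ^ (n + 2 * m) / ((Nat.factorial m : ℝ) * (Nat.factorial (n + m) : ℝ))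

/-- Modified Bessel function of the second kind `K_n`. -/
noncomputable def besselK (n : ℕ) (x : ℝ) : ℝ :=
  ∫ t in Set.Ioi (0 : ℝ), Real.exp (-x * Real.cosh t) * Real.cosh ((n : ℝ) * t)

/-- `Λ_n(λ,b) = I_n(λb) K_n(λ)`. -/
noncomputable def Lam (n : ℕ) (l b : ℝ) : ℝ := besselI n (l * b) * besselK n l

/-- `Ω_n(x) = I_1(x)K_1(x) − I_n(x)K_n(x)`. -/
noncomputable def Om (n : ℕ) (x : ℝ) : ℝ :=
  besselI 1 x * besselK 1 x - besselI n x * besselK n x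

/-- Discriminant `Δ_n(λ,b)`. -/
noncomputable def Del (n : ℕ) (l b : ℝ) : ℝ :=
  (b * (Om n l + Om n (l * b)) - (1 + b ^ 2) * Lam 1 l b) ^ 2 - 4 * b ^ 2 * Lam n l b ^ 2

/-- `B_n(λ,b)`. -/
noncomputable def Bfun (n : ℕ) (l b : ℝ) : ℝ :=
  (1 - b ^ 2) * Lam 1 l b + b * (Om n l - Om n (l * b))

/-- `Ω_n^+(λ,b)`. -/
noncomputable def OmP (n : ℕ) (l b : ℝ) : ℝ :=
  (Bfun n l b + Real.sqrt (Del n l b)) / (2 * b)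

/-- `Ω_n^−(λ,b)`. -/
noncomputable def OmM (n : ℕ) (l b : ℝ) : ℝ :=
  (Bfun n l b - Real.sqrt (Del n l b)) / (2 * b)

/-- The matrix `M_n(λ,b,Ω)`. -/
noncomputable def Mmat (n : ℕ) (l b W : ℝ) : Matrix (Fin 2) (Fin 2) ℝ :=
  !![Om n l - W - b * Lam 1 l b, b * Lam n l b;
     -Lam n l b, Lam 1 l b - b * (Om n (l * b) + W)]

open Set Topology

theorem besselI_term_le {x : ℝ} (hx : 0 < x) (n m : ℕ) :
    (x / 2) ^ (n + 2 * m) / ((Nat.factorial m : ℝ) * (Nat.factorial (n + m) : ℝ)) ≤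
      (x / 2) ^ n / (Nat.factorial n : ℝ) *
        ((x ^ 2 / 4 / (n + 1)) ^ m / (Nat.factorial m : ℝ)) := by
  have hfac : (Nat.factorial n : ℝ) * ((n : ℝ) + 1) ^ m ≤ (Nat.factorial (n + m) : ℝ) := by
    exact_mod_cast Nat.factorial_mul_pow_le_factorial
  have hm : (0 : ℝ) < Nat.factorial m := by exact_mod_cast Nat.factorial_pos m
  have hn : (0 : ℝ) < Nat.factorial n := by exact_mod_cast Nat.factorial_pos n
  have hR : (x / 2) ^ n / (Nat.factorial n : ℝ) *
        ((x ^ 2 / 4 / (n + 1)) ^ m / (Nat.factorial m : ℝ)) =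
      (x / 2) ^ (n + 2 * m) /
        ((Nat.factorial m : ℝ) * ((Nat.factorial n : ℝ) * ((n : ℝ) + 1) ^ m)) := by
    have h4 : x ^ 2 / 4 = (x / 2) ^ 2 := by ring
    rw [h4, pow_add, pow_mul, div_pow ((x / 2) ^ 2)]
    generalize (x / 2) ^ n = A, ((x / 2) ^ 2) ^ m = B, ((n : ℝ) + 1) ^ m = C
    ring
  rw [hR]
  gcongr

theorem besselI_majorant_hasSum (x : ℝ) (n : ℕ) :
    HasSum (fun m : ℕ => (x / 2) ^ n / (Nat.factorial n : ℝ) *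
        ((x ^ 2 / 4 / (n + 1)) ^ m / (Nat.factorial m : ℝ)))
      ((x / 2) ^ n / (Nat.factorial n : ℝ) * Real.exp (x ^ 2 / 4 / (n + 1))) := by
  refine HasSum.mul_left _ ?_
  generalize x ^ 2 / 4 / ((n : ℝ) + 1) = z
  rw [Real.exp_eq_exp_ℝ]
  exact NormedSpace.expSeries_div_hasSum_exp z

theorem besselI_summable {x : ℝ} (hx : 0 < x) (n : ℕ) :
    Summable fun m : ℕ =>
      (x / 2) ^ (n + 2 * m) / ((Nat.factorial m : ℝ) * (Nat.factorial (n + m) : ℝ)) :=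
  Summable.of_nonneg_of_le (fun m => by positivity) (besselI_term_le hx n)
    (besselI_majorant_hasSum x n).summable

theorem besselI_le {x : ℝ} (hx : 0 < x) (n : ℕ) :
    besselI n x ≤ (x / 2) ^ n / (Nat.factorial n : ℝ) * Real.exp (x ^ 2 / 4 / (n + 1)) := by
  rw [← (besselI_majorant_hasSum x n).tsum_eq]
  exact (besselI_summable hx n).tsum_le_tsum (besselI_term_le hx n)
    (besselI_majorant_hasSum x n).summable

theorem le_besselI {x : ℝ} (hx : 0 < x) (n : ℕ) :
    (x / 2) ^ n / (Nat.factorial n : ℝ) ≤ besselI n x := by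
  have h := (besselI_summable hx n).le_tsum 0 (fun m _ => by positivity)
  simpa [besselI] using h

theorem besselI_pos {x : ℝ} (hx : 0 < x) (n : ℕ) : 0 < besselI n x :=
  lt_of_lt_of_le (by positivity) (le_besselI hx n)

theorem besselI_one_mul_lt {x b : ℝ} (hx : 0 < x) (hb : b ∈ Ioo (0 : ℝ) 1) :
    besselI 1 (x * b) < b * besselI 1 x := by
  unfold besselI
  rw [← tsum_mul_left]
  have key : ∀ m : ℕ, (x * b / 2) ^ (1 + 2 * m) /
        ((Nat.factorial m : ℝ) * (Nat.factorial (1 + m) : ℝ)) =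
      b ^ (2 * m) * (b * ((x / 2) ^ (1 + 2 * m) /
        ((Nat.factorial m : ℝ) * (Nat.factorial (1 + m) : ℝ)))) := by
    intro m
    rw [show x * b / 2 = b * (x / 2) by ring, mul_pow, pow_add b 1]
    ring
  have hpos : ∀ m : ℕ, 0 < b * ((x / 2) ^ (1 + 2 * m) /
        ((Nat.factorial m : ℝ) * (Nat.factorial (1 + m) : ℝ))) := by
    intro m
    have := hb.1
    positivity
  refine Summable.tsum_lt_tsum (i := 1) (fun m => ?_) ?_
    (besselI_summable (mul_pos hx hb.1) 1) ((besselI_summable hx 1).mul_left b)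
  · rw [key]
    exact mul_le_of_le_one_left (hpos m).le (pow_le_one₀ hb.1.le hb.2.le)
  · rw [key]
    exact mul_lt_of_lt_one_left (hpos 1) (pow_lt_one₀ hb.1.le hb.2 (by norm_num))

theorem integral_pow_mul_exp_neg {c : ℝ} (hc : 0 < c) (k : ℕ) :
    ∫ u in Ioi (0 : ℝ), u ^ k * Real.exp (-(c * u)) = (Nat.factorial k : ℝ) / c ^ (k + 1) := by
  have h := Real.integral_rpow_mul_exp_neg_mul_Ioi (a := (k : ℝ) + 1) (by positivity) hc
  rw [Real.Gamma_nat_eq_factorial] at h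
  simp only [add_sub_cancel_right, Real.rpow_natCast] at h
  rw [h, ← Nat.cast_succ, Real.rpow_natCast, one_div, inv_pow, inv_mul_eq_div]

theorem integrableOn_pow_mul_exp_neg {c : ℝ} (hc : 0 < c) (k : ℕ) :
    IntegrableOn (fun u : ℝ => u ^ k * Real.exp (-(c * u))) (Ioi 0) := by
  refine .of_integral_ne_zero ?_
  rw [integral_pow_mul_exp_neg hc]
  positivity

theorem besselK_kernel_le {x u : ℝ} (hx : 0 < x) (hu : 0 < u) (k : ℕ) :
    u ^ k * Real.exp (-(x / 2 * (u + u⁻¹))) ≤ u ^ k * Real.exp (-(x / 2 * u)) := by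
  gcongr
  have : 0 < u⁻¹ := inv_pos.2 hu
  linarith

theorem integrableOn_besselK_kernel {x : ℝ} (hx : 0 < x) (k : ℕ) :
    IntegrableOn (fun u : ℝ => u ^ k * Real.exp (-(x / 2 * (u + u⁻¹)))) (Ioi 0) := by
  refine Integrable.mono' (integrableOn_pow_mul_exp_neg (half_pos hx) k) ?_ ?_
  · exact Measurable.aestronglyMeasurable (by fun_prop)
  · refine (ae_restrict_iff' measurableSet_Ioi).2 (ae_of_all _ fun u hu => ?_)
    have hu' : (0 : ℝ) < u := hu
    rw [Real.norm_of_nonneg (by positivity)]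
    exact besselK_kernel_le hx hu' k

theorem exp_mul_besselK_kernel (x t : ℝ) (k : ℕ) :
    |Real.exp t| • (Real.exp t ^ k * Real.exp (-(x / 2 * (Real.exp t + (Real.exp t)⁻¹)))) =
      Real.exp (-x * Real.cosh t) * Real.exp (((k + 1 : ℕ) : ℝ) * t) := by
  rw [abs_of_pos (Real.exp_pos t), smul_eq_mul, ← mul_assoc, ← pow_succ', ← Real.exp_nat_mul,
    mul_comm, Real.cosh_eq, ← Real.exp_neg t]
  congr 2
  ring

theorem integrable_exp_neg_cosh_mul_exp {x : ℝ} (hx : 0 < x) (k : ℕ) :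
    Integrable fun t : ℝ => Real.exp (-x * Real.cosh t) * Real.exp (((k + 1 : ℕ) : ℝ) * t) := by
  have h := (integrableOn_image_iff_integrableOn_abs_deriv_smul (s := univ) (f := Real.exp)
    (f' := Real.exp) MeasurableSet.univ
    (fun t _ => (Real.hasDerivAt_exp t).hasDerivWithinAt) Real.exp_injective.injOn
    (fun u : ℝ => u ^ k * Real.exp (-(x / 2 * (u + u⁻¹))))).1
    (by rw [image_univ, Real.range_exp]; exact integrableOn_besselK_kernel hx k)
  simpa only [exp_mul_besselK_kernel, integrableOn_univ] using h

theorem integral_exp_neg_cosh_mul_exp (x : ℝ) (k : ℕ) :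
    ∫ t : ℝ, Real.exp (-x * Real.cosh t) * Real.exp (((k + 1 : ℕ) : ℝ) * t) =
      ∫ u in Ioi (0 : ℝ), u ^ k * Real.exp (-(x / 2 * (u + u⁻¹))) := by
  have h := integral_image_eq_integral_abs_deriv_smul (s := univ) (f := Real.exp)
    (f' := Real.exp) MeasurableSet.univ
    (fun t _ => (Real.hasDerivAt_exp t).hasDerivWithinAt) Real.exp_injective.injOn
    (fun u : ℝ => u ^ k * Real.exp (-(x / 2 * (u + u⁻¹))))
  rw [image_univ, Real.range_exp] at h
  simpa only [exp_mul_besselK_kernel, setIntegral_univ] using h.symm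

theorem integrable_besselK_integrand {x : ℝ} (hx : 0 < x) (k : ℕ) :
    Integrable fun t : ℝ => Real.exp (-x * Real.cosh t) * Real.cosh (((k + 1 : ℕ) : ℝ) * t) := by
  have h := integrable_exp_neg_cosh_mul_exp hx k
  convert! ((h.add h.comp_neg).div_const 2) using 1
  ext t
  simp only [Pi.add_apply, Real.cosh_neg, Real.cosh_eq (((k + 1 : ℕ) : ℝ) * t), mul_neg]
  ring

theorem besselK_succ_eq {x : ℝ} (hx : 0 < x) (k : ℕ) :
    besselK (k + 1) x =
      (∫ u in Ioi (0 : ℝ), u ^ k * Real.exp (-(x / 2 * (u + u⁻¹)))) / 2 := by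
  have h := integrable_exp_neg_cosh_mul_exp hx k
  rw [← integral_exp_neg_cosh_mul_exp, ← integral_add_compl (measurableSet_Ioi (a := (0 : ℝ))) h,
    compl_Ioi]
  have hneg := integral_comp_neg_Iic (0 : ℝ) (fun t : ℝ =>
    Real.exp (-x * Real.cosh (-t)) * Real.exp (((k + 1 : ℕ) : ℝ) * -t))
  simp only [neg_neg, neg_zero] at hneg
  rw [hneg, ← integral_add h.integrableOn h.comp_neg.integrableOn, ← integral_div]
  unfold besselK
  congr 1
  ext t
  simp only [Real.cosh_neg, Real.cosh_eq (((k + 1 : ℕ) : ℝ) * t), mul_neg]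
  ring

theorem besselK_succ_le {x : ℝ} (hx : 0 < x) (k : ℕ) :
    besselK (k + 1) x ≤ (Nat.factorial k : ℝ) / (x / 2) ^ (k + 1) / 2 := by
  rw [besselK_succ_eq hx, ← integral_pow_mul_exp_neg (half_pos hx)]
  refine div_le_div_of_nonneg_right ?_ zero_le_two
  exact setIntegral_mono_on (integrableOn_besselK_kernel hx k)
    (integrableOn_pow_mul_exp_neg (half_pos hx) k) measurableSet_Ioi
    fun u hu => besselK_kernel_le hx hu k

theorem le_besselK_add_two {x : ℝ} (hx : 0 < x) (j : ℕ) :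
    (Nat.factorial (j + 1) : ℝ) / (x / 2) ^ (j + 2) / 2 * (1 - x ^ 2 / 4 / (j + 1)) ≤
      besselK (j + 2) x := by
  have h1 := integrableOn_pow_mul_exp_neg (half_pos hx) (j + 1)
  have h0 := (integrableOn_pow_mul_exp_neg (half_pos hx) j).const_mul (x / 2)
  have hint : ∫ u in Ioi (0 : ℝ), (u ^ (j + 1) * Real.exp (-(x / 2 * u)) -
        x / 2 * (u ^ j * Real.exp (-(x / 2 * u)))) =
      (Nat.factorial (j + 1) : ℝ) / (x / 2) ^ (j + 2) * (1 - x ^ 2 / 4 / (j + 1)) := by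
    rw [integral_sub h1 h0, integral_const_mul, integral_pow_mul_exp_neg (half_pos hx),
      integral_pow_mul_exp_neg (half_pos hx), Nat.factorial_succ]
    push_cast
    field_simp
    ring
  rw [besselK_succ_eq hx, div_mul_eq_mul_div, ← hint]
  refine div_le_div_of_nonneg_right ?_ zero_le_two
  refine setIntegral_mono_on (h1.sub h0) (integrableOn_besselK_kernel hx (j + 1))
    measurableSet_Ioi fun u hu => ?_
  have hu' : (0 : ℝ) < u := hu
  have hexp : 1 - x / 2 * u⁻¹ ≤ Real.exp (-(x / 2 * u⁻¹)) := by
    linarith [Real.add_one_le_exp (-(x / 2 * u⁻¹))]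
  calc u ^ (j + 1) * Real.exp (-(x / 2 * u)) - x / 2 * (u ^ j * Real.exp (-(x / 2 * u)))
      = u ^ (j + 1) * Real.exp (-(x / 2 * u)) * (1 - x / 2 * u⁻¹) := by
        field_simp
        ring
    _ ≤ u ^ (j + 1) * Real.exp (-(x / 2 * u)) * Real.exp (-(x / 2 * u⁻¹)) := by gcongr
    _ = u ^ (j + 1) * Real.exp (-(x / 2 * (u + u⁻¹))) := by
        rw [mul_assoc, ← Real.exp_add]
        ring_nf

theorem besselK_succ_antitoneOn (k : ℕ) : AntitoneOn (besselK (k + 1)) (Ioi 0) := by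
  intro x hx y hy hxy
  refine setIntegral_mono_on (integrable_besselK_integrand hy k).integrableOn
    (integrable_besselK_integrand hx k).integrableOn measurableSet_Ioi fun t _ => ?_
  have hc := Real.cosh_pos t
  have hc' := Real.cosh_pos (((k + 1 : ℕ) : ℝ) * t)
  gcongr

theorem besselK_succ_pos {x : ℝ} (hx : 0 < x) (k : ℕ) : 0 < besselK (k + 1) x := by
  have hpos : ∀ t : ℝ, 0 < Real.exp (-x * Real.cosh t) * Real.cosh (((k + 1 : ℕ) : ℝ) * t) :=
    fun t => mul_pos (Real.exp_pos _) (Real.cosh_pos _)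
  refine (integral_pos_iff_support_of_nonneg (fun t => (hpos t).le)
    (integrable_besselK_integrand hx k).integrableOn).2 ?_
  rw [Function.support_eq_univ (fun t => (hpos t).ne')]
  simp

theorem eventually_besselI_mul_besselK_bounds {x y : ℝ} (hx : 0 < x) (hy : 0 < y) :
    ∀ᶠ n : ℕ in atTop, 4 / 5 * ((x / y) ^ n / (2 * n)) ≤ besselI n x * besselK n y ∧
      besselI n x * besselK n y ≤ 6 / 5 * ((x / y) ^ n / (2 * n)) := by
  have hlim : ∀ c : ℝ, Tendsto (fun j : ℕ => c / ((j : ℝ) + 1)) atTop (𝓝 0) := fun c => by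
    simpa [div_eq_mul_inv] using (tendsto_one_div_add_atTop_nhds_zero_nat (𝕜 := ℝ)).const_mul c
  have hexp : Tendsto (fun n : ℕ => Real.exp (x ^ 2 / 4 / ((n : ℝ) + 1))) atTop (𝓝 1) := by
    simpa [Function.comp_def] using (Real.continuous_exp.tendsto 0).comp (hlim (x ^ 2 / 4))
  have hE : ∀ᶠ j : ℕ in atTop,
      Real.exp (x ^ 2 / 4 / (((j + 2 : ℕ) : ℝ) + 1)) < 6 / 5 :=
    (tendsto_add_atTop_nat 2).eventually (hexp.eventually_lt_const (by norm_num))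
  have hD : ∀ᶠ j : ℕ in atTop, y ^ 2 / 4 / ((j : ℝ) + 1) < 1 / 5 :=
    (hlim (y ^ 2 / 4)).eventually_lt_const (by norm_num)
  have hmain : ∀ᶠ j : ℕ in atTop,
      4 / 5 * ((x / y) ^ (j + 2) / (2 * ((j + 2 : ℕ) : ℝ))) ≤
        besselI (j + 2) x * besselK (j + 2) y ∧
      besselI (j + 2) x * besselK (j + 2) y ≤
        6 / 5 * ((x / y) ^ (j + 2) / (2 * ((j + 2 : ℕ) : ℝ))) := by
    filter_upwards [hE, hD] with j hE hD
    have hprod : (x / 2) ^ (j + 2) / (Nat.factorial (j + 2) : ℝ) *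
          ((Nat.factorial (j + 1) : ℝ) / (y / 2) ^ (j + 2) / 2) =
        (x / y) ^ (j + 2) / (2 * ((j + 2 : ℕ) : ℝ)) := by
      rw [Nat.factorial_succ (j + 1), div_pow, div_pow, div_pow]
      push_cast
      field_simp
      ring
    have hK := besselK_succ_pos hy (j + 1)
    have hI := besselI_pos hx (j + 2)
    rw [← hprod]
    constructor
    · calc _ = (x / 2) ^ (j + 2) / (Nat.factorial (j + 2) : ℝ) *
            ((Nat.factorial (j + 1) : ℝ) / (y / 2) ^ (j + 2) / 2 * (4 / 5)) := by ring
        _ ≤ besselI (j + 2) x * ((Nat.factorial (j + 1) : ℝ) / (y / 2) ^ (j + 2) / 2 *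
            (1 - y ^ 2 / 4 / (j + 1))) := by
          gcongr
          · exact le_besselI hx _
          · linarith
        _ ≤ _ := by
          gcongr
          exact le_besselK_add_two hy j
    · calc
        besselI (j + 2) x * besselK (j + 2) y
          ≤ ((x / 2) ^ (j + 2) / (Nat.factorial (j + 2) : ℝ) * (6 / 5)) *
            ((Nat.factorial (j + 1) : ℝ) / (y / 2) ^ (j + 2) / 2) := by
          gcongr
          · exact (besselI_le hx _).trans (by gcongr)
          · exact besselK_succ_le hy (j + 1)
        _ = _ := by ring
  obtain ⟨N, hN⟩ := eventually_atTop.1 hmain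
  refine eventually_atTop.2 ⟨N + 2, fun n hn => ?_⟩
  obtain ⟨j, rfl⟩ := Nat.exists_eq_add_of_le' (show 2 ≤ n by omega)
  exact hN j (by omega)

theorem eventually_besselI_mul_besselK_mul_lt {x y : ℝ} (hx : 0 < x) (hxy : x ≤ y) :
    ∀ᶠ m : ℕ in atTop, ∀ k : ℕ, 2 ≤ k → 0 ≤ besselI (k * m) x * besselK (k * m) y ∧
      besselI (k * m) x * besselK (k * m) y < besselI m x * besselK m y := by
  have hy : 0 < y := hx.trans_le hxy
  obtain ⟨N, hN⟩ := eventually_atTop.1 (eventually_besselI_mul_besselK_bounds hx hy)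
  refine eventually_atTop.2 ⟨N + 1, fun m hm k hk => ?_⟩
  have hkm : m ≤ k * m := Nat.le_mul_of_pos_left m (by omega)
  obtain ⟨hlk, huk⟩ := hN (k * m) (by omega)
  obtain ⟨hlm, -⟩ := hN m (by omega)
  refine ⟨le_trans (by positivity) hlk, huk.trans_lt (lt_of_lt_of_le ?_ hlm)⟩
  have hm0 : (0 : ℝ) < m := by exact_mod_cast (show 0 < m by omega)
  have hk2 : (2 : ℝ) ≤ k := by exact_mod_cast hk
  have hpow : (x / y) ^ (k * m) ≤ (x / y) ^ m :=
    pow_le_pow_of_le_one (by positivity) ((div_le_one hy).2 hxy) hkm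
  have hr : 0 < (x / y) ^ m / (2 * m) := by positivity
  calc 6 / 5 * ((x / y) ^ (k * m) / (2 * ((k * m : ℕ) : ℝ)))
      ≤ 6 / 5 * ((x / y) ^ m / (2 * (2 * m))) := by
        push_cast
        gcongr
    _ = 3 / 5 * ((x / y) ^ m / (2 * m)) := by ring
    _ < 4 / 5 * ((x / y) ^ m / (2 * m)) := by linarith

theorem tendsto_besselI_mul_besselK {x y : ℝ} (hx : 0 < x) (hxy : x ≤ y) :
    Tendsto (fun n : ℕ => besselI n x * besselK n y) atTop (𝓝 0) := by
  have hy : 0 < y := hx.trans_le hxy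
  have hbd := eventually_besselI_mul_besselK_bounds hx hy
  have hlim : Tendsto (fun n : ℕ => 6 / 5 * (1 / (n : ℝ))) atTop (𝓝 0) := by
    simpa using (tendsto_one_div_atTop_nhds_zero_nat (𝕜 := ℝ)).const_mul (6 / 5)
  refine squeeze_zero' ?_ ?_ hlim
  · filter_upwards [hbd] with n hn using le_trans (by positivity) hn.1
  · filter_upwards [hbd, eventually_gt_atTop 0] with n hn hn0
    refine hn.2.trans ?_
    have hn' : (0 : ℝ) < n := by exact_mod_cast hn0
    have hpow : (x / y) ^ n ≤ 1 := pow_le_one₀ (by positivity) ((div_le_one hy).2 hxy)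
    gcongr
    linarith

theorem spectral_gap_pos {l b : ℝ} (hl : 0 < l) (hb : b ∈ Ioo (0 : ℝ) 1) :
    (1 + b ^ 2) * Lam 1 l b <
      b * (besselI 1 l * besselK 1 l + besselI 1 (l * b) * besselK 1 (l * b)) := by
  have hI := besselI_one_mul_lt hl hb
  have hIpos := besselI_pos (mul_pos hl hb.1) 1
  have hKpos : 0 < besselK 1 l := besselK_succ_pos hl 0
  have hK : besselK 1 l ≤ besselK 1 (l * b) :=
    besselK_succ_antitoneOn 0 (mul_pos hl hb.1) hl (mul_le_of_le_one_right hl.le hb.2.le)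
  have h1 := mul_lt_mul_of_pos_right hI hKpos
  have h2 : b * besselK 1 l ≤ besselK 1 (l * b) :=
    (mul_le_of_le_one_left hKpos.le hb.2.le).trans hK
  have h3 := mul_le_mul_of_nonneg_left h2 (mul_pos hb.1 hIpos).le
  unfold Lam
  linarith

theorem det_Mmat (n : ℕ) (l b W : ℝ) :
    (Mmat n l b W).det = (Om n l - W - b * Lam 1 l b) * (Lam 1 l b - b * (Om n (l * b) + W)) +
      b * Lam n l b ^ 2 := by
  rw [Mmat, Matrix.det_fin_two_of]
  ring

theorem det_Mmat_eq_zero {n : ℕ} {l b s : ℝ} (hb : b ≠ 0) (hs : s ^ 2 = Del n l b) :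
    (Mmat n l b ((Bfun n l b + s) / (2 * b))).det = 0 := by
  rw [det_Mmat]
  unfold Del at hs
  unfold Bfun
  generalize Om n l = A, Om n (l * b) = C at *
  field_simp
  linear_combination hs

theorem det_Mmat_ne_zero {m n : ℕ} {l b W : ℝ} (hb : 0 < b)
    (hgap : (1 + b ^ 2) * Lam 1 l b < b * (Om m l + Om m (l * b)))
    (hA : Om m l < Om n l) (hC : Om m (l * b) < Om n (l * b))
    (hL : Lam n l b ^ 2 ≤ Lam m l b ^ 2) (hW : (Mmat m l b W).det = 0) :
    (Mmat n l b W).det ≠ 0 := by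
  rw [det_Mmat] at hW ⊢
  set u := Om m l - W - b * Lam 1 l b with hu
  set v := b * (Om m (l * b) + W) - Lam 1 l b with hv
  have huv : u * v = b * Lam m l b ^ 2 := by linear_combination -hW
  have hsum : 0 < b * u + v := by
    rw [hu, hv]
    linarith
  have huv0 : 0 ≤ u * v := huv ▸ mul_nonneg hb.le (sq_nonneg _)
  have hu0 : 0 ≤ u := by
    by_contra! h
    have hbu := mul_neg_of_pos_of_neg hb h
    exact huv0.not_gt (mul_neg_of_neg_of_pos h (by linarith))
  have hv0 : 0 ≤ v := by
    by_contra! h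
    have hu' : 0 < u := pos_of_mul_pos_right (a := b) (by linarith) hb.le
    exact huv0.not_gt (mul_neg_of_pos_of_neg hu' h)
  have hlt : u * v < (Om n l - W - b * Lam 1 l b) * (b * (Om n (l * b) + W) - Lam 1 l b) := by
    have hC' := mul_lt_mul_of_pos_left hC hb
    exact mul_lt_mul'' (by linarith) (by linarith) hu0 hv0
  have hL' := mul_le_mul_of_nonneg_left hL hb.le
  intro h
  linarith

theorem tendsto_Om {x : ℝ} (hx : 0 < x) :
    Tendsto (fun n : ℕ => Om n x) atTop (𝓝 (besselI 1 x * besselK 1 x)) := by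
  simpa [Om] using tendsto_const_nhds.sub (tendsto_besselI_mul_besselK hx le_rfl)

/-- for `m` large, `Δ_m(λ,b) > 0`, `det M_m(λ,b,Ω_m^±(λ,b)) = 0` and
`det M_{km}(λ,b,Ω_m^±(λ,b)) ≠ 0` for every `k ≥ 2` (one-dimensionality of the kernel). -/
theorem kernel_one_dimensional (l b : ℝ) (hl : 0 < l) (hb : b ∈ Set.Ioo (0:ℝ) 1) :
    ∃ N : ℕ, ∀ m : ℕ, N ≤ m →
      0 < Del m l b ∧
      (Mmat m l b (OmP m l b)).det = 0 ∧
      (Mmat m l b (OmM m l b)).det = 0 ∧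
      ∀ k : ℕ, 2 ≤ k →
        (Mmat (k * m) l b (OmP m l b)).det ≠ 0 ∧
        (Mmat (k * m) l b (OmM m l b)).det ≠ 0 := by
  have hb0 := hb.1
  have hlb : 0 < l * b := mul_pos hl hb0
  have hlbl : l * b ≤ l := mul_le_of_le_one_right hl.le hb.2.le
  have hgapLim : Tendsto (fun n : ℕ => b * (Om n l + Om n (l * b)) - (1 + b ^ 2) * Lam 1 l b)
      atTop (𝓝 (b * (besselI 1 l * besselK 1 l + besselI 1 (l * b) * besselK 1 (l * b)) -
        (1 + b ^ 2) * Lam 1 l b)) :=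
    (((tendsto_Om hl).add (tendsto_Om hlb)).const_mul b).sub_const _
  have hLamLim : Tendsto (fun n : ℕ => Lam n l b) atTop (𝓝 0) :=
    tendsto_besselI_mul_besselK hlb hlbl
  have hpos := sub_pos.2 (spectral_gap_pos hl hb)
  have hDelLim := (hgapLim.pow 2).sub ((hLamLim.pow 2).const_mul (4 * b ^ 2))
  have hDel : ∀ᶠ n : ℕ in atTop, 0 < Del n l b :=
    hDelLim.eventually_const_lt (by simpa using pow_pos hpos 2)
  refine eventually_atTop.1 ?_
  filter_upwards [hDel, hgapLim.eventually_const_lt hpos,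
    eventually_besselI_mul_besselK_mul_lt hl le_rfl,
    eventually_besselI_mul_besselK_mul_lt hlb le_rfl,
    eventually_besselI_mul_besselK_mul_lt hlb hlbl] with m hD hgap hA hC hL
  have hP : (Mmat m l b (OmP m l b)).det = 0 := det_Mmat_eq_zero hb0.ne' (Real.sq_sqrt hD.le)
  have hM : (Mmat m l b (OmM m l b)).det = 0 :=
    det_Mmat_eq_zero (s := -Real.sqrt (Del m l b)) hb0.ne' (by rw [neg_sq, Real.sq_sqrt hD.le])
  have hne : ∀ k : ℕ, 2 ≤ k → ∀ W : ℝ, (Mmat m l b W).det = 0 → (Mmat (k * m) l b W).det ≠ 0 :=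
    fun k hk W => det_Mmat_ne_zero hb0 (sub_pos.1 hgap) (sub_lt_sub_left (hA k hk).2 _)
      (sub_lt_sub_left (hC k hk).2 _) (pow_le_pow_left₀ (hL k hk).1 (hL k hk).2.le 2)
  exact ⟨hD, hP, hM, fun k hk => ⟨hne k hk _ hP, hne k hk _ hM⟩⟩
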